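/- For every n, p(n) · n! / 2^(n^2) tends to 0 as n → ∞, where p(n) = Fintype.card (Nat.Partition n); that is, the sequence (fun n => (Fintype.card (Nat.Partition n) : ℝ) * (Nat.factorial n) / 2^(n^2)) tends to 0 along atTop. -/

import Mathlib

open Filter

lemma card_partition_le_aux (n : ℕ) : Fintype.card (Nat.Partition n) ≤ 2 ^ n :=
  (Fintype.card_le_of_surjective _ Nat.Partition.ofComposition_surj).trans
    ((composition_card n).le.trans (Nat.pow_le_pow_right (by norm_num) (Nat.sub_le n 1)))

lemma factorial_bound_aux (n : ℕ) : 4 ^ n * n.factorial ≤ 2 * 2 ^ (n ^ 2) := by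
  rcases n with _ | n
  · norm_num
  induction n with
  | zero => norm_num
  | succ k ih =>
    have h3 : 4 * (k + 2) ≤ 2 ^ (2 * k + 3) := by
      have : 2 ^ (2 * k + 3) = 8 * (2 ^ k * 2 ^ k) := by ring
      have h4 : k < 2 ^ k := Nat.lt_two_pow_self
      rw [this]; nlinarith
    calc 4 ^ (k + 1 + 1) * (k + 1 + 1).factorial
        = (4 ^ (k + 1) * (k + 1).factorial) * (4 * (k + 2)) := by
          rw [Nat.factorial_succ (k + 1)]; ring
      _ ≤ (2 * 2 ^ ((k + 1) ^ 2)) * 2 ^ (2 * k + 3) := Nat.mul_le_mul ih h3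
      _ = 2 * 2 ^ ((k + 1 + 1) ^ 2) := by
          rw [mul_assoc, ← pow_add]; congr 2; ring

/-- The sequence `p(n) · n! / 2^(n^2)` tends to `0`, where
`p(n) = Fintype.card (Nat.Partition n)` is the number of integer partitions
of `n`. -/
theorem partition_mul_factorial_div_twoPow_tendsto_zero :
    Filter.Tendsto
      (fun n : ℕ =>
        (Fintype.card (Nat.Partition n) : ℝ) * (Nat.factorial n) / 2 ^ (n ^ 2))
      Filter.atTop (nhds 0) := by
  have hlim : Tendsto (fun n : ℕ => 2 * (1 / 2 : ℝ) ^ n) atTop (nhds 0) := by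
    simpa using (tendsto_pow_atTop_nhds_zero_of_lt_one (r := (1 / 2 : ℝ))
      (by norm_num) (by norm_num)).const_mul 2
  refine squeeze_zero (fun n => by positivity) (fun n => ?_) hlim
  have h1 : (Fintype.card (Nat.Partition n) : ℝ) ≤ 2 ^ n := by
    exact_mod_cast card_partition_le_aux n
  have h2 : (4 : ℝ) ^ n * n.factorial ≤ 2 * 2 ^ (n ^ 2) := by
    exact_mod_cast factorial_bound_aux n
  rw [div_le_iff₀ (by positivity)]
  have h4 : (4 : ℝ) ^ n = 2 ^ n * 2 ^ n := by rw [← mul_pow]; norm_num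
  have h5 : (1 / 2 : ℝ) ^ n * 2 ^ n = 1 := by rw [← mul_pow]; norm_num
  calc (Fintype.card (Nat.Partition n) : ℝ) * n.factorial
      ≤ 2 ^ n * n.factorial := by gcongr
    _ = ((1 / 2 : ℝ) ^ n * 2 ^ n) * (2 ^ n * n.factorial) := by rw [h5, one_mul]
    _ = (1 / 2 : ℝ) ^ n * (4 ^ n * n.factorial) := by rw [h4]; ring
    _ ≤ (1 / 2 : ℝ) ^ n * (2 * 2 ^ (n ^ 2)) := by gcongr
    _ = 2 * (1 / 2 : ℝ) ^ n * 2 ^ (n ^ 2) := by ring
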